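/- If for every compact B ⊆ X one has ∫_{Γ_X} Σ_{x∈γ} η_x(𝔛_B) dμ(γ) < ∞, then μ_cl-almost every configuration γ is locally finite, i.e., γ(B) < ∞ for every compact B ⊆ X. -/

import Mathlib

open MeasureTheory ENNReal

section RandomPoints

open Set Filter Topology

variable {Ω X ι : Type*}

/-- The indices of the active points of `z · ω` lying in `F`, the point with index `j` being
active on `E j`. -/
def activeIn (E : ι → Set Ω) (z : ι → Ω → X) (F : Set X) (ω : Ω) : Set ι :=
  {j | ω ∈ E j ∧ z j ω ∈ F}

/-- The event that at least `m` active points lie in `F`. -/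
def atLeastIn (E : ι → Set Ω) (z : ι → Ω → X) (m : ℕ) (F : Set X) : Set Ω :=
  {ω | ∃ s : Finset ι, s.card = m ∧ ↑s ⊆ activeIn E z F ω}

/-- The event that active points accumulate in some compact subset of `F`. -/
def accumulatesIn [TopologicalSpace X] (E : ι → Set Ω) (z : ι → Ω → X) (F : Set X) : Set Ω :=
  {ω | ∃ B ⊆ F, IsCompact B ∧ (activeIn E z B ω).Infinite}

lemma activeIn_mono (E : ι → Set Ω) (z : ι → Ω → X) (ω : Ω) {F G : Set X} (h : F ⊆ G) :
    activeIn E z F ω ⊆ activeIn E z G ω :=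
  fun _ hj => ⟨hj.1, h hj.2⟩

lemma atLeastIn_mono (E : ι → Set Ω) (z : ι → Ω → X) (m : ℕ) {F G : Set X} (h : F ⊆ G) :
    atLeastIn E z m F ⊆ atLeastIn E z m G :=
  fun ω ⟨s, hs, hsF⟩ => ⟨s, hs, hsF.trans (activeIn_mono E z ω h)⟩

lemma atLeastIn_antitone (E : ι → Set Ω) (z : ι → Ω → X) (F : Set X) :
    Antitone fun m => atLeastIn E z m F := by
  rintro m n hmn ω ⟨s, hs, hsF⟩
  obtain ⟨t, hts, ht⟩ := Finset.exists_subset_card_eq (hmn.trans_eq hs.symm)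
  exact ⟨t, ht, (Finset.coe_subset.2 hts).trans hsF⟩

lemma infinite_activeIn_of_forall {E : ι → Set Ω} {z : ι → Ω → X} {F : Set X} {ω : Ω}
    (h : ∀ m, ω ∈ atLeastIn E z m F) : (activeIn E z F ω).Infinite := by
  intro hfin
  obtain ⟨s, hs, hsF⟩ := h (hfin.toFinset.card + 1)
  have : s ⊆ hfin.toFinset := fun j hj => hfin.mem_toFinset.2 (hsF hj)
  have := Finset.card_le_card this
  omega

lemma accumulatesIn_subset_atLeastIn [TopologicalSpace X] (E : ι → Set Ω) (z : ι → Ω → X)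
    (F : Set X) (m : ℕ) : accumulatesIn E z F ⊆ atLeastIn E z m F := by
  rintro ω ⟨B, hBF, -, hB⟩
  obtain ⟨s, hs, hcard⟩ := hB.exists_subset_card_eq m
  exact ⟨s, hcard, hs.trans (activeIn_mono E z ω hBF)⟩

variable [MeasurableSpace Ω]

lemma measurableSet_atLeastIn [Countable ι] [MeasurableSpace X] {E : ι → Set Ω} {z : ι → Ω → X}
    (hE : ∀ j, MeasurableSet (E j)) (hz : ∀ j, Measurable (z j)) (m : ℕ) {F : Set X}
    (hF : MeasurableSet F) : MeasurableSet (atLeastIn E z m F) := by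
  have : atLeastIn E z m F =
      ⋃ s : Finset ι, ⋃ _ : s.card = m, ⋂ j ∈ s, E j ∩ z j ⁻¹' F := by
    ext ω
    simp [atLeastIn, activeIn, subset_def]
  rw [this]
  refine .iUnion fun s => .iUnion fun _ => Finset.measurableSet_biInter _ fun j _ => ?_
  exact (hE j).inter (hz j hF)

lemma exists_compact_cover_of_measurable [Countable ι] [TopologicalSpace X] [PolishSpace X]
    [MeasurableSpace X] [BorelSpace X] (Q : Measure Ω) [IsFiniteMeasure Q] {z : ι → Ω → X}
    (hz : ∀ j, Measurable (z j)) :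
    ∃ C : ι × ℕ → Set X, (∀ p, IsCompact (C p)) ∧ ∀ᵐ ω ∂Q, ∀ j, ∃ n, z j ω ∈ C (j, n) := by
  have key (j : ι) : ∀ n : ℕ, ∃ K : Set X, IsCompact K ∧
      Q.map (z j) Kᶜ ≤ ((n : ℝ≥0∞) + 1)⁻¹ := by
    intro n
    obtain ⟨K, hK, hle⟩ := isTightMeasureSet_iff_exists_isCompact_measure_compl_le.1
      (isTightMeasureSet_singleton (μ := Q.map (z j))) ((n : ℝ≥0∞) + 1)⁻¹ (by simp)
    exact ⟨K, hK, hle _ rfl⟩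
  choose K hK hle using key
  refine ⟨fun p => K p.1 p.2, fun p => hK _ _, ?_⟩
  rw [ae_all_iff]
  intro j
  rw [ae_iff]
  refine le_antisymm (ENNReal.le_of_forall_pos_le_add fun ε hε _ => ?_) zero_le
  obtain ⟨n, hn⟩ := ENNReal.exists_inv_nat_lt (ENNReal.coe_pos.2 hε).ne'
  calc Q {ω | ¬ ∃ n, z j ω ∈ K j n} ≤ Q (z j ⁻¹' (K j n)ᶜ) :=
        measure_mono fun ω hω hmem => hω ⟨n, hmem⟩
    _ = Q.map (z j) (K j n)ᶜ := (Measure.map_apply (hz j) (hK j n).measurableSet.compl).symm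
    _ ≤ ((n : ℝ≥0∞) + 1)⁻¹ := hle j n
    _ ≤ (n : ℝ≥0∞)⁻¹ := ENNReal.inv_le_inv.2 le_self_add
    _ ≤ 0 + ε := by simpa using hn.le

lemma exists_isCompact_lt_measure_atLeastIn [Countable ι] [TopologicalSpace X] [PolishSpace X]
    [MeasurableSpace X] [BorelSpace X] (Q : Measure Ω) [IsFiniteMeasure Q] (E : ι → Set Ω)
    {z : ι → Ω → X} (hz : ∀ j, Measurable (z j)) {m : ℕ} {F : Set X} {a : ℝ≥0∞}
    (ha : a < Q (atLeastIn E z m F)) :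
    ∃ L, IsCompact L ∧ a < Q (atLeastIn E z m (F ∩ L)) := by
  classical
  obtain ⟨C, hC, hcov⟩ := exists_compact_cover_of_measurable Q hz
  let L (t : Finset (ι × ℕ)) : Set X := ⋃ p ∈ t, C p
  have hLmono : Monotone L := fun s t hst => biUnion_subset_biUnion_left hst
  have hdir : Directed (· ⊆ ·) fun t => atLeastIn E z m (F ∩ L t) :=
    Monotone.directed_le fun s t hst =>
      atLeastIn_mono E z m (inter_subset_inter_right F (hLmono hst))
  have hle : Q (atLeastIn E z m F) ≤ Q (⋃ t, atLeastIn E z m (F ∩ L t)) := by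
    refine measure_mono_ae ?_
    filter_upwards [hcov] with ω hω
    rintro ⟨s, hs, hsF⟩
    choose n hn using hω
    refine mem_iUnion.2 ⟨s.image fun j => (j, n j), s, hs, fun j hj => ?_⟩
    refine ⟨(hsF hj).1, (hsF hj).2, mem_biUnion (x := (j, n j)) ?_ (hn j)⟩
    exact Finset.mem_coe.2 (Finset.mem_image_of_mem _ hj)
  rw [hdir.measure_iUnion] at hle
  obtain ⟨t, ht⟩ := lt_iSup_iff.1 (ha.trans_le hle)
  exact ⟨L t, t.isCompact_biUnion fun p _ => hC p, ht⟩

lemma exists_finite_lt_measure_accumulatesIn [PseudoMetricSpace X] [TopologicalSpace.SeparableSpace X]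
    (Q : Measure Ω) (E : ι → Set Ω) (z : ι → Ω → X) {F : Set X} {a : ℝ≥0∞} {r : ℝ} (hr : 0 < r)
    (ha : a < Q (accumulatesIn E z F)) :
    ∃ t : Set X, t.Finite ∧ a < Q (accumulatesIn E z (F ∩ ⋃ x ∈ t, Metric.ball x r)) := by
  classical
  obtain ⟨D, hDc, hDd⟩ := TopologicalSpace.exists_countable_dense X
  have := hDc.to_subtype
  let U (t : Finset D) : Set X := ⋃ x ∈ t, Metric.ball (x : X) r
  have hUmono : Monotone U := fun s t hst => biUnion_subset_biUnion_left hst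
  have hdir : Directed (· ⊆ ·) fun t => accumulatesIn E z (F ∩ U t) :=
    Monotone.directed_le fun s t hst ω ⟨B, hB, h⟩ =>
      ⟨B, hB.trans (inter_subset_inter_right F (hUmono hst)), h⟩
  have hsub : accumulatesIn E z F ⊆ ⋃ t, accumulatesIn E z (F ∩ U t) := by
    rintro ω ⟨B, hBF, hB, hinf⟩
    obtain ⟨t, ht⟩ := hB.elim_finite_subcover (fun x : D => Metric.ball (x : X) r)
      (fun _ => Metric.isOpen_ball) fun x _ => by
        obtain ⟨d, hd, hxd⟩ := hDd.exists_dist_lt x hr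
        exact mem_iUnion.2 ⟨⟨d, hd⟩, hxd⟩
    exact mem_iUnion.2 ⟨t, B, subset_inter hBF ht, hB, hinf⟩
  have hle := measure_mono (μ := Q) hsub
  rw [hdir.measure_iUnion] at hle
  obtain ⟨t, ht⟩ := lt_iSup_iff.1 (ha.trans_le hle)
  refine ⟨Subtype.val '' (t : Set D), t.finite_toSet.image _, ?_⟩
  rw [biUnion_image]
  exact ht

/-- If every fixed compact set almost surely contains finitely many points of a countable random
family in a Polish space, then almost surely all compact sets do. -/
theorem ae_forall_isCompact_finite_activeIn [Countable ι] [TopologicalSpace X] [PolishSpace X]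
    [MeasurableSpace X] [BorelSpace X] (Q : Measure Ω) [IsFiniteMeasure Q] {E : ι → Set Ω}
    {z : ι → Ω → X} (hE : ∀ j, MeasurableSet (E j)) (hz : ∀ j, Measurable (z j))
    (hfin : ∀ B, IsCompact B → ∀ᵐ ω ∂Q, (activeIn E z B ω).Finite) :
    ∀ᵐ ω ∂Q, ∀ B, IsCompact B → (activeIn E z B ω).Finite := by
  let := TopologicalSpace.upgradeIsCompletelyMetrizable X
  suffices h : Q (accumulatesIn E z univ) = 0 by
    refine (measure_eq_zero_iff_ae_notMem.1 h).mono fun ω hω B hB => ?_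
    by_contra hinf
    exact hω ⟨B, subset_univ _, hB, hinf⟩
  by_contra hne
  obtain ⟨a, ha0, ha⟩ := exists_between (pos_iff_ne_zero.2 hne)
  have step (F : {F : Set X // a < Q (accumulatesIn E z F)}) (m : ℕ) :
      ∃ t : Set X, t.Finite ∧ a < Q (accumulatesIn E z
        (F.1 ∩ ⋃ x ∈ t, Metric.ball x (1 / ((m : ℝ) + 1)))) :=
    exists_finite_lt_measure_accumulatesIn Q E z Nat.one_div_pos_of_nat F.2
  choose t htfin ht using step
  let K : ℕ → {F : Set X // a < Q (accumulatesIn E z F)} :=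
    Nat.rec ⟨univ, ha⟩ fun m F => ⟨_, ht F m⟩
  have hKsucc (m : ℕ) : (K (m + 1)).1 =
      (K m).1 ∩ ⋃ x ∈ t (K m) m, Metric.ball x (1 / ((m : ℝ) + 1)) := rfl
  have hKanti : Antitone fun m => (K m).1 :=
    antitone_nat_of_succ_le fun m => (hKsucc m).trans_subset inter_subset_left
  have hL (m : ℕ) : ∃ L, IsCompact L ∧ a < Q (atLeastIn E z m ((K m).1 ∩ L)) :=
    exists_isCompact_lt_measure_atLeastIn Q E hz
      ((K m).2.trans_le (measure_mono (accumulatesIn_subset_atLeastIn E z _ m)))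
  choose L hLc hL using hL
  have htb : TotallyBounded (⋃ m, (K m).1 ∩ L m) := by
    rw [Metric.totallyBounded_iff]
    intro ε hε
    obtain ⟨m, hm⟩ := exists_nat_one_div_lt hε
    obtain ⟨u, hufin, hu⟩ := Metric.totallyBounded_iff.1
      ((finite_Iic m).isCompact_biUnion fun i _ => hLc i).totallyBounded ε hε
    refine ⟨t (K m) m ∪ u, (htfin _ _).union hufin, iUnion_subset fun n x hx => ?_⟩
    rw [biUnion_union]
    rcases le_or_gt n m with hnm | hnm
    · exact Or.inr (hu (mem_biUnion (mem_Iic.2 hnm) hx.2))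
    · have hxK : x ∈ (K (m + 1)).1 := hKanti (Nat.succ_le_of_lt hnm) hx.1
      rw [hKsucc] at hxK
      exact Or.inl (iUnion₂_mono (fun y _ => Metric.ball_subset_ball hm.le) hxK.2)
  let B := closure (⋃ m, (K m).1 ∩ L m)
  have hB : IsCompact B := htb.closure.isCompact_of_isClosed isClosed_closure
  have hlt (m : ℕ) : a ≤ Q (atLeastIn E z m B) :=
    (hL m).le.trans (measure_mono (atLeastIn_mono E z m
      ((subset_iUnion (fun m => (K m).1 ∩ L m) m).trans subset_closure)))
  have hlim := tendsto_measure_iInter_atTop (μ := Q)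
    (fun m => (measurableSet_atLeastIn hE hz m hB.isClosed.measurableSet).nullMeasurableSet)
    (atLeastIn_antitone E z B) ⟨0, measure_ne_top _ _⟩
  have hnull : Q (⋂ m, atLeastIn E z m B) = 0 :=
    measure_mono_null
      (fun ω hω hBfin => infinite_activeIn_of_forall (mem_iInter.1 hω) hBfin)
      (ae_iff.1 (hfin B hB))
  rw [hnull] at hlim
  exact ha0.not_ge (ge_of_tendsto' hlim hlt)

end RandomPoints

section Clusters

open Set Filter Topology

variable {X : Type*}

lemma measurable_of_forall_comp_sigmaMk {α β : Type*} {δ : α → Type*}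
    [∀ a, MeasurableSpace (δ a)] [MeasurableSpace β] {f : Sigma δ → β}
    (h : ∀ a, Measurable (f ∘ Sigma.mk a)) : Measurable f := by
  intro s hs
  exact MeasurableSpace.measurableSet_iInf.2 fun a => h a hs

lemma measurableSet_sigma_of_forall {α : Type*} {δ : α → Type*} [∀ a, MeasurableSpace (δ a)]
    {s : Set (Sigma δ)} (h : ∀ a, MeasurableSet (Sigma.mk a ⁻¹' s)) : MeasurableSet s :=
  MeasurableSpace.measurableSet_iInf.2 h

lemma measurableSet_exists_mem [MeasurableSpace X] {B : Set X} (hB : MeasurableSet B) :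
    MeasurableSet {yv : Σ n : ℕ, Fin n → X | ∃ i, yv.2 i ∈ B} := by
  refine measurableSet_sigma_of_forall fun n => ?_
  have : Sigma.mk n ⁻¹' {yv : Σ n : ℕ, Fin n → X | ∃ i, yv.2 i ∈ B} =
      ⋃ i : Fin n, (fun v : Fin n → X => v i) ⁻¹' B := by
    ext v
    simp
  rw [this]
  exact .iUnion fun i => measurable_pi_apply i hB

/-- The `i`-th point of a cluster, with default value `x₀` if there is no such point. -/
def clusterPoint (x₀ : X) (i : ℕ) (v : Σ n : ℕ, Fin n → X) : X :=
  if h : i < v.1 then v.2 ⟨i, h⟩ else x₀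

lemma measurable_clusterPoint [MeasurableSpace X] (x₀ : X) (i : ℕ) :
    Measurable (clusterPoint x₀ i) := by
  refine measurable_of_forall_comp_sigmaMk fun n => ?_
  by_cases h : i < n
  · have : clusterPoint x₀ i ∘ Sigma.mk n = fun v : Fin n → X => v ⟨i, h⟩ := by
      ext v
      simp [clusterPoint, h]
    rw [this]
    exact measurable_pi_apply _
  · have : clusterPoint x₀ i ∘ Sigma.mk n = fun _ : Fin n → X => x₀ := by
      ext v
      simp [clusterPoint, h]
    rw [this]
    exact measurable_const

/-- Measures on a sequence space whose cylinder probabilities are products of those of a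
measurable family of measures depend measurably on the parameters. -/
lemma measurable_of_lintegral_prod_eq {S : Type*} [MeasurableSpace X] [MeasurableSpace S]
    (η : X → Measure S) (hη : ∀ B, MeasurableSet B → Measurable fun x => η x B)
    (P : (ℕ → X) → Measure (ℕ → S)) [∀ γ, IsProbabilityMeasure (P γ)]
    (hP : ∀ (γ : ℕ → X) (s : Finset ℕ) (g : ℕ → S → ℝ≥0∞), (∀ k, Measurable (g k)) →
      ∫⁻ y, ∏ k ∈ s, g k (y k) ∂(P γ) = ∏ k ∈ s, ∫⁻ z, g k z ∂(η (γ k))) :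
    Measurable P := by
  refine Measurable.measure_of_isPiSystem_of_isProbabilityMeasure
    generateFrom_squareCylinders.symm
    (isPiSystem_squareCylinders (fun _ => MeasurableSpace.isPiSystem_measurableSet) (by simp)) ?_
  rintro _ ⟨s, t, ht, rfl⟩
  have ht' (k : ℕ) : MeasurableSet (t k) := ht k (mem_univ k)
  have heq (γ : ℕ → X) : P γ ((s : Set ℕ).pi t) = ∏ k ∈ s, η (γ k) (t k) := by
    have h := hP γ s (fun k => (t k).indicator 1) fun k => measurable_one.indicator (ht' k)
    simp only [lintegral_indicator_one (ht' _)] at h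
    rw [← h, ← lintegral_indicator_one (.pi s.countable_toSet fun k _ => ht' k)]
    congr with y
    classical
    simp [indicator_apply, Finset.prod_ite_zero, Set.mem_pi]
  simp only [heq]
  exact Finset.measurable_prod _ fun k _ => (hη _ (ht' k)).comp (measurable_pi_apply k)

lemma tsum_sum_indicator_lt_top (x₀ : X) (B : Set X) (y : ℕ → Σ n : ℕ, Fin n → X)
    (h : {j : ℕ × ℕ | j.2 < (y j.1).1 ∧ clusterPoint x₀ j.2 (y j.1) ∈ B}.Finite) :
    (∑' k, ∑ i : Fin (y k).1, B.indicator (fun _ => (1 : ℝ≥0∞)) ((y k).2 i)) < ⊤ := by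
  rw [tsum_eq_sum (s := (h.image Prod.fst).toFinset)]
  · refine ENNReal.sum_lt_top.2 fun k _ => ENNReal.sum_lt_top.2 fun i _ => ?_
    exact (indicator_le_self _ _ _).trans_lt ENNReal.one_lt_top
  · intro k hk
    refine Finset.sum_eq_zero fun i _ => indicator_of_notMem (fun hi => hk ?_) _
    rw [Set.Finite.mem_toFinset]
    exact ⟨(k, i), ⟨i.2, by simpa [clusterPoint] using hi⟩, rfl⟩

lemma finite_setOf_clusterPoint_mem (x₀ : X) (B : Set X) (y : ℕ → Σ n : ℕ, Fin n → X)
    (h : {k | ∃ i, (y k).2 i ∈ B}.Finite) :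
    {j : ℕ × ℕ | j.2 < (y j.1).1 ∧ clusterPoint x₀ j.2 (y j.1) ∈ B}.Finite := by
  refine (h.biUnion fun k _ => ((finite_Iio (y k).1).image (Prod.mk k))).subset ?_
  rintro ⟨k, i⟩ ⟨hi, hmem⟩
  refine mem_biUnion (x := k) ⟨⟨i, hi⟩, ?_⟩ ⟨i, hi, rfl⟩
  simpa [clusterPoint, show i < (y k).1 from hi] using hmem

end Clusters

/-- Theorem 3.5(a). If for every compact `B ⊆ X` one has
`∫_{Γ_X} Σ_{x∈γ} η_x(𝔛_B) dμ(γ) < ∞`, then `μ_cl`-a.a. configurations are locally finite.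
Encoding: centre configurations are indexed as `γ : ℕ → X`; clusters live in
`𝔛 = ⨆_n X^n = Σ n, Fin n → X`; the in-cluster marks `(ȳ_k) : ℕ → 𝔛` are distributed
according to the product `⊗_k η_{γ(k)}`, encoded by a family `P γ` with the product
property `hP`; `𝔛_B = {ȳ : some coordinate of ȳ lies in B}`; the cluster configuration
`𝔮(γ,ȳ)` counts `Σ_k #{i : ȳ_k(i) ∈ B}` points in `B`. -/
theorem cluster_measure_locally_finite
    {X : Type*} [TopologicalSpace X] [PolishSpace X] [MeasurableSpace X] [BorelSpace X]
    (η : X → Measure (Σ n : ℕ, Fin n → X)) [∀ x, IsProbabilityMeasure (η x)]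
    (hη : ∀ B : Set (Σ n : ℕ, Fin n → X), MeasurableSet B → Measurable fun x => η x B)
    (μ : Measure (ℕ → X)) [IsProbabilityMeasure μ]
    (P : (ℕ → X) → Measure (ℕ → Σ n : ℕ, Fin n → X))
    [∀ γ, IsProbabilityMeasure (P γ)]
    (hP : ∀ (γ : ℕ → X) (s : Finset ℕ) (g : ℕ → (Σ n : ℕ, Fin n → X) → ℝ≥0∞),
      (∀ k, Measurable (g k)) →
      ∫⁻ y, ∏ k ∈ s, g k (y k) ∂(P γ) = ∏ k ∈ s, ∫⁻ z, g k z ∂(η (γ k)))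
    (hfin : ∀ B : Set X, IsCompact B →
      ∫⁻ γ, ∑' k, η (γ k) {yv | ∃ i, yv.2 i ∈ B} ∂μ < ⊤) :
    ∀ᵐ γ ∂μ, ∀ᵐ y ∂(P γ), ∀ B : Set X, IsCompact B →
      (∑' k, ∑ i : Fin (y k).1, B.indicator (fun _ => (1 : ℝ≥0∞)) ((y k).2 i)) < ⊤ := by
  obtain ⟨γ₀⟩ : Nonempty (ℕ → X) := nonempty_of_isProbabilityMeasure μ
  let x₀ := γ₀ 0
  have hPm : Measurable P := measurable_of_lintegral_prod_eq η hη P hP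
  have hmarg (γ : ℕ → X) (k : ℕ) {S : Set (Σ n : ℕ, Fin n → X)} (hS : MeasurableSet S) :
      P γ {y | y k ∈ S} = η (γ k) S := by
    have h := hP γ {k} (fun _ => S.indicator 1) fun _ => measurable_one.indicator hS
    simp only [Finset.prod_singleton, lintegral_indicator_one hS] at h
    have hSk : MeasurableSet {y : ℕ → Σ n : ℕ, Fin n → X | y k ∈ S} := measurable_pi_apply k hS
    rw [← h, ← lintegral_indicator_one hSk]
    rfl
  have : IsFiniteMeasure (μ.bind P) :=
    ⟨by simp [Measure.bind_apply .univ hPm.aemeasurable]⟩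
  have hlocal (B : Set X) (hB : IsCompact B) :
      ∀ᵐ y ∂(μ.bind P), {k | ∃ i, (y k).2 i ∈ B}.Finite := by
    let S : Set (Σ n : ℕ, Fin n → X) := {yv | ∃ i, yv.2 i ∈ B}
    have hS : MeasurableSet S := measurableSet_exists_mem hB.measurableSet
    let A (k : ℕ) : Set (ℕ → Σ n : ℕ, Fin n → X) := {y | y k ∈ S}
    have hA (k : ℕ) : MeasurableSet (A k) := measurable_pi_apply k hS
    refine ae_finite_setOfPred_mem (s := A) ?_
    have hint (k : ℕ) : μ.bind P (A k) = ∫⁻ γ, η (γ k) S ∂μ := by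
      rw [Measure.bind_apply (hA k) hPm.aemeasurable]
      exact lintegral_congr fun γ => hmarg γ k hS
    have hm (k : ℕ) : AEMeasurable (fun γ : ℕ → X => η (γ k) S) μ :=
      ((hη S hS).comp (measurable_pi_apply k)).aemeasurable
    simp only [hint]
    rw [← lintegral_tsum hm]
    exact (hfin B hB).ne
  have hE (j : ℕ × ℕ) : MeasurableSet {y : ℕ → Σ n : ℕ, Fin n → X | j.2 < (y j.1).1} := by
    have hS : MeasurableSet {v : Σ n : ℕ, Fin n → X | j.2 < v.1} :=
      measurableSet_sigma_of_forall fun n => .const (j.2 < n)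
    exact hS.preimage (measurable_pi_apply (X := fun _ : ℕ => Σ n : ℕ, Fin n → X) j.1)
  have hall := ae_forall_isCompact_finite_activeIn (μ.bind P) hE
    (fun j => (measurable_clusterPoint x₀ j.2).comp (measurable_pi_apply j.1))
    fun B hB => (hlocal B hB).mono fun y hy => finite_setOf_clusterPoint_mem x₀ B y hy
  refine (Measure.ae_ae_of_ae_bind hPm.aemeasurable hall).mono fun γ hγ => ?_
  exact hγ.mono fun y hy B hB => tsum_sum_indicator_lt_top x₀ B y (hy B hB)
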